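/- Let G be a graph with vertex set containing disjoint sets T₁, T₂, each node-well-linked in G, of size κ each, with maximum degree of G at most d. Suppose T₁ ∪ T₂ is 1/3-well-linked in G. Then for every cluster S ⊆ V(G) whose boundary Γ(S) is α'-well-linked in G[S] for some 0 < α' < 1, and such that G is edge-minimal with T₁ ∪ T₂ being 1/3-well-linked, we have |Γ(S)| ≤ 12κd/α'. -/

import Mathlib

attribute [local instance] Classical.propDecidable

noncomputable section

variable {V : Type}

/-- The degree of a vertex `v` in the simple graph `G`. -/
def deg [Fintype V] (G : SimpleGraph V) (v : V) : ℕ :=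
  (Finset.univ.filter (fun u => G.Adj v u)).card

/-- The boundary `Γ(C)` of a cluster `C`: the vertices of `C` having a neighbor outside `C`. -/
def bdry (G : SimpleGraph V) (C : Finset V) : Finset V :=
  C.filter (fun v => ∃ u, u ∉ C ∧ G.Adj v u)

/-- The number of edges `|E(A,B)|` with one endpoint in `A` and the other in `B`
(for disjoint `A`, `B`). -/
def cutCard (G : SimpleGraph V) (A B : Finset V) : ℕ :=
  ((A ×ˢ B).filter (fun ab => G.Adj ab.1 ab.2)).card

/-- A flow in `G[C]` from `A` to `B`, in which every vertex of `A` sends exactly one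
unit of flow, every vertex of `B` receives exactly one unit of flow, and the total
flow through any edge is at most `η`. -/
def HasUnitFlowIn (G : SimpleGraph V) (C A B : Finset V) (η : ℝ) : Prop :=
  ∃ (P : Finset (Σ u v : V, G.Walk u v)) (f : (Σ u v : V, G.Walk u v) → ℝ),
    (∀ p ∈ P, 0 ≤ f p) ∧
    (∀ p ∈ P, p.1 ∈ A ∧ p.2.1 ∈ B) ∧
    (∀ p ∈ P, ∀ x ∈ p.2.2.support, x ∈ C) ∧
    (∀ a ∈ A, ∑ p ∈ P.filter (fun p => p.1 = a), f p = 1) ∧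
    (∀ b ∈ B, ∑ p ∈ P.filter (fun p => p.2.1 = b), f p = 1) ∧
    (∀ e : Sym2 V, ∑ p ∈ P.filter (fun p => e ∈ p.2.2.edges), f p ≤ η)

/-- `T` is `α`-well-linked in `G[C]`: every pair of disjoint equal-sized subsets of `T`
can be connected, one-to-one, by a flow of edge-congestion at most `1/α` inside `C`. -/
def WellLinkedIn (G : SimpleGraph V) (C T : Finset V) (α : ℝ) : Prop :=
  ∀ T' T'' : Finset V, T' ⊆ T → T'' ⊆ T → Disjoint T' T'' → T'.card = T''.card →
    HasUnitFlowIn G C T' T'' (1 / α)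

/-- `T` is `(k',α)`-well-linked in `G[C]`. -/
def WellLinkedKIn (G : SimpleGraph V) (C T : Finset V) (k' : ℕ) (α : ℝ) : Prop :=
  ∀ T' T'' : Finset V, T' ⊆ T → T'' ⊆ T → Disjoint T' T'' → T'.card = T''.card →
    T'.card ≤ k' → HasUnitFlowIn G C T' T'' (1 / α)

/-- `T` is `α`-well-linked in `G`. -/
def WellLinked [Fintype V] (G : SimpleGraph V) (T : Finset V) (α : ℝ) : Prop :=
  WellLinkedIn G Finset.univ T α

/-- There is a family of pairwise vertex-disjoint paths in `G`, one starting at each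
vertex of `A`, each ending at a (necessarily distinct) vertex of `B`. -/
def NodeLinkedSets (G : SimpleGraph V) (A B : Finset V) : Prop :=
  ∃ P : Finset (Σ u v : V, G.Walk u v),
    (∀ p ∈ P, p.2.2.IsPath ∧ p.1 ∈ A ∧ p.2.1 ∈ B) ∧
    (∀ a ∈ A, ∃ p ∈ P, p.1 = a) ∧
    (∀ p ∈ P, ∀ q ∈ P, p ≠ q → ∀ x ∈ p.2.2.support, x ∉ q.2.2.support)

/-- `T` is node-well-linked in `G`. -/
def NodeWellLinked (G : SimpleGraph V) (T : Finset V) : Prop :=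
  ∀ T' T'' : Finset V, T' ⊆ T → T'' ⊆ T → Disjoint T' T'' → T'.card = T''.card →
    NodeLinkedSets G T' T''

/-- `(T₁, T₂)` are node-linked in `G`. -/
def NodeLinked (G : SimpleGraph V) (T₁ T₂ : Finset V) : Prop :=
  ∀ T' T'' : Finset V, T' ⊆ T₁ → T'' ⊆ T₂ → T'.card = T''.card → NodeLinkedSets G T' T''

/-- `(A,B)` is a `ρ`-balanced cut of the cluster `C` with respect to the vertex set `Γ`. -/
def IsBalancedCut (Γ A B C : Finset V) (ρ : ℝ) : Prop :=
  A ∪ B = C ∧ Disjoint A B ∧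
    ρ * (Γ.card : ℝ) ≤ ((A ∩ Γ).card : ℝ) ∧ ρ * (Γ.card : ℝ) ≤ ((B ∩ Γ).card : ℝ)

/-- Reachability by a walk all of whose darts satisfy `r`. -/
def Reach (H : SimpleGraph V) (r : V → V → Prop) (a v : V) : Prop :=
  ∃ w : H.Walk a v, ∀ d ∈ w.darts, r d.fst d.snd

lemma Reach.refl (H : SimpleGraph V) (r : V → V → Prop) (a : V) : Reach H r a a :=
  ⟨SimpleGraph.Walk.nil, by simp⟩

lemma Reach.step {H : SimpleGraph V} {r : V → V → Prop} {a u v : V} (h : Reach H r a u)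
    (hadj : H.Adj u v) (hr : r u v) : Reach H r a v := by
  obtain ⟨w, hw⟩ := h
  refine ⟨w.concat hadj, ?_⟩
  intro d hd
  rw [SimpleGraph.Walk.darts_concat] at hd
  simp only [List.concat_eq_append, List.mem_append, List.mem_singleton] at hd
  rcases hd with hd | hd
  · exact hw d hd
  · subst hd; exact hr

/-- The unit flow along a path. -/
lemma path_flow [Fintype V] {H : SimpleGraph V} {r : V → V → Prop} {a b : V} (p : H.Walk a b)
    (hp : p.IsPath) (hr : ∀ d ∈ p.darts, r d.fst d.snd) :
    ∃ χ : V → V → ℤ, (∀ u v, χ u v = - χ v u) ∧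
      (∀ v, ∑ u, χ v u = (if v = a then 1 else 0) - (if v = b then 1 else 0)) ∧
      (∀ u v, s(u, v) ∉ p.edges → χ u v = 0) ∧
      (∀ u v, s(u, v) ∈ p.edges → H.Adj u v ∧ ((χ u v = 1 ∧ r u v) ∨ (χ u v = -1 ∧ r v u))) := by
  induction p with
  | nil => exact ⟨fun _ _ => 0, by simp, by simp, by simp, by simp⟩
  | @cons x y z h p ih =>
    rw [SimpleGraph.Walk.cons_isPath_iff] at hp
    obtain ⟨χ, h1, h2, h3, h4⟩ := ih hp.1 (fun d hd => hr d (by simp [hd]))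
    have hxy : r x y := hr ⟨(x, y), h⟩ (by simp)
    have hne : x ≠ y := h.ne
    have hnot : s(x, y) ∉ p.edges := fun hh => hp.2 (p.fst_mem_support_of_mem_edges hh)
    have hnot' : s(y, x) ∉ p.edges := by rwa [Sym2.eq_swap]
    refine ⟨fun u v => (if u = x ∧ v = y then 1 else 0) - (if u = y ∧ v = x then 1 else 0)
      + χ u v, ?_, ?_, ?_, ?_⟩
    · intro u v
      have := h1 u v
      simp only [this, and_comm (a := v = x), and_comm (a := v = y)]
      ring
    · intro v
      rw [Finset.sum_add_distrib, Finset.sum_sub_distrib, h2]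
      have e1 : ∑ u, (if v = x ∧ u = y then (1:ℤ) else 0) = if v = x then 1 else 0 := by
        by_cases hv : v = x <;> simp [hv]
      have e2 : ∑ u, (if v = y ∧ u = x then (1:ℤ) else 0) = if v = y then 1 else 0 := by
        by_cases hv : v = y <;> simp [hv]
      rw [e1, e2]; ring
    · intro u v huv
      simp only [SimpleGraph.Walk.edges_cons, List.mem_cons, not_or] at huv
      have c1 : ¬ (u = x ∧ v = y) := by rintro ⟨rfl, rfl⟩; exact huv.1 rfl
      have c2 : ¬ (u = y ∧ v = x) := by rintro ⟨rfl, rfl⟩; exact huv.1 Sym2.eq_swap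
      simp [c1, c2, h3 u v huv.2]
    · intro u v huv
      simp only [SimpleGraph.Walk.edges_cons, List.mem_cons] at huv
      by_cases c1 : u = x ∧ v = y
      · obtain ⟨rfl, rfl⟩ := c1
        refine ⟨h, Or.inl ⟨?_, hxy⟩⟩
        simp [h3 _ _ hnot, hne]
      by_cases c2 : u = y ∧ v = x
      · obtain ⟨rfl, rfl⟩ := c2
        refine ⟨h.symm, Or.inr ⟨?_, hxy⟩⟩
        simp [h3 _ _ hnot', hne.symm]
      have : s(u, v) ∈ p.edges := by
        rcases huv with huv | huv
        · rw [Sym2.eq_iff] at huv; tauto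
        · exact huv
      simpa [c1, c2] using h4 u v this

lemma Reach.flow [Fintype V] {H : SimpleGraph V} {r : V → V → Prop} {a b : V}
    (h : Reach H r a b) :
    ∃ (p : H.Walk a b) (χ : V → V → ℤ), (∀ u v, χ u v = - χ v u) ∧
      (∀ v, ∑ u, χ v u = (if v = a then 1 else 0) - (if v = b then 1 else 0)) ∧
      (∀ u v, s(u, v) ∉ p.edges → χ u v = 0) ∧
      (∀ u v, s(u, v) ∈ p.edges → H.Adj u v ∧ ((χ u v = 1 ∧ r u v) ∨ (χ u v = -1 ∧ r v u))) := by
  obtain ⟨w, hw⟩ := h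
  exact ⟨w.bypass, path_flow w.bypass w.bypass_isPath
    (fun d hd => hw d (w.darts_bypass_subset_darts hd))⟩

lemma sum_cut [Fintype V] (F : V → V → ℤ) (hF : ∀ u v, F u v = - F v u) (R : Finset V) :
    ∑ v ∈ R, ∑ u, F v u = ∑ v ∈ R, ∑ u ∈ Rᶜ, F v u := by
  have h0 : ∑ v ∈ R, ∑ u ∈ R, F v u = 0 := by
    have : ∑ v ∈ R, ∑ u ∈ R, F v u = - ∑ v ∈ R, ∑ u ∈ R, F v u := by
      conv_rhs => rw [Finset.sum_comm]
      rw [← Finset.sum_neg_distrib]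
      refine Finset.sum_congr rfl fun v _ => ?_
      rw [← Finset.sum_neg_distrib]
      exact Finset.sum_congr rfl fun u _ => hF v u
    omega
  have : ∀ v ∈ R, ∑ u, F v u = ∑ u ∈ R, F v u + ∑ u ∈ Rᶜ, F v u := fun v _ =>
    (Finset.sum_add_sum_compl R _).symm
  rw [Finset.sum_congr rfl this, Finset.sum_add_distrib, h0, zero_add]

/-- Decomposition of an integral flow into paths. -/
lemma decompose [Fintype V] (H : SimpleGraph V) (n : ℕ) : ∀ (A B : Finset V) (F : V → V → ℤ),
    A.card = n → B.card = n → Disjoint A B → (∀ u v, F u v = - F v u) →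
    (∀ u v, F u v ≠ 0 → H.Adj u v) →
    (∀ v, ∑ u, F v u = (if v ∈ A then 1 else 0) - (if v ∈ B then 1 else 0)) →
    ∃ P : Finset (Σ u v : V, H.Walk u v),
      (∀ p ∈ P, p.1 ∈ A ∧ p.2.1 ∈ B) ∧
      (∀ a ∈ A, (P.filter (fun p => p.1 = a)).card = 1) ∧
      (∀ b ∈ B, (P.filter (fun p => p.2.1 = b)).card = 1) ∧
      (∀ u v, ((P.filter (fun p => s(u, v) ∈ p.2.2.edges)).card : ℤ) ≤ |F u v|) := by
  induction n with
  | zero =>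
    intro A B F hA hB _ _ _ _
    rw [Finset.card_eq_zero] at hA hB
    subst hA hB
    exact ⟨∅, by simp, by simp, by simp, by simp⟩
  | succ n ih =>
    intro A B F hA hB hAB hF hadj hex
    obtain ⟨a, ha⟩ : A.Nonempty := by rw [← Finset.card_pos]; omega
    set R : Finset V := Finset.univ.filter (fun v => Reach H (fun u v => 0 < F u v) a v) with hR
    have haR : a ∈ R := by simp [hR, Reach.refl]
    have hneg : ∑ v ∈ R, ∑ u, F v u ≤ 0 := by
      rw [sum_cut F hF]
      refine Finset.sum_nonpos fun v hv => Finset.sum_nonpos fun u hu => ?_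
      by_contra hpos
      push Not at hpos
      simp only [hR, Finset.mem_compl, Finset.mem_filter, Finset.mem_univ, true_and] at hv hu
      exact hu (hv.step (hadj _ _ hpos.ne') hpos)
    obtain ⟨b, hbR, hb⟩ : ∃ b ∈ R, b ∈ B := by
      by_contra hcon
      push Not at hcon
      have : (0:ℤ) < ∑ v ∈ R, ∑ u, F v u := by
        refine Finset.sum_pos' (fun v hv => ?_) ⟨a, haR, ?_⟩
        · rw [hex, if_neg (hcon v hv)]; split_ifs <;> simp
        · rw [hex, if_neg (hcon a haR), if_pos ha]; simp
      omega
    have hreach : Reach H (fun u v => 0 < F u v) a b := by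
      simpa [hR] using hbR
    obtain ⟨p, χ, x1, x2, x3, x4⟩ := hreach.flow
    have hab : a ≠ b := fun h => Finset.disjoint_left.1 hAB ha (h ▸ hb)
    have haB : a ∉ B := Finset.disjoint_left.1 hAB ha
    have hbA : b ∉ A := Finset.disjoint_right.1 hAB hb
    obtain ⟨P, p1, p2, p3, p4⟩ := ih (A.erase a) (B.erase b) (fun u v => F u v - χ u v)
      (by rw [Finset.card_erase_of_mem ha]; omega) (by rw [Finset.card_erase_of_mem hb]; omega)
      (hAB.mono (Finset.erase_subset _ _) (Finset.erase_subset _ _))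
      (fun u v => by rw [hF u v, x1 u v]; ring)
      (fun u v h => by
        by_cases he : s(u, v) ∈ p.edges
        · exact (x4 u v he).1
        · rw [x3 u v he, sub_zero] at h; exact hadj u v h)
      (fun v => by
        rw [Finset.sum_sub_distrib, hex, x2]
        simp only [Finset.mem_erase]
        by_cases h1 : v = a
        · subst h1; simp [ha, hab, haB]
        by_cases h2 : v = b
        · subst h2; simp [hb, hab.symm, hbA]
        simp [h1, h2])
    have hnP : (⟨a, b, p⟩ : Σ u v : V, H.Walk u v) ∉ P := fun h => by
      have := (p1 _ h).1; simp at this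
    refine ⟨insert ⟨a, b, p⟩ P, ?_, ?_, ?_, ?_⟩
    · intro q hq
      rcases Finset.mem_insert.1 hq with rfl | hq
      · exact ⟨ha, hb⟩
      · exact ⟨Finset.mem_of_mem_erase (p1 q hq).1, Finset.mem_of_mem_erase (p1 q hq).2⟩
    · intro x hx
      rw [Finset.filter_insert]
      by_cases hxa : x = a
      · subst hxa
        rw [if_pos rfl]
        have : P.filter (fun p => p.1 = x) = ∅ := by
          refine Finset.filter_eq_empty_iff.2 fun q hq h => ?_
          have := (p1 q hq).1; simp [h] at this
        rw [this]; simp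
      · rw [if_neg (fun h => hxa h.symm)]
        exact p2 x (Finset.mem_erase.2 ⟨hxa, hx⟩)
    · intro x hx
      rw [Finset.filter_insert]
      by_cases hxa : x = b
      · subst hxa
        rw [if_pos rfl]
        have : P.filter (fun p => p.2.1 = x) = ∅ := by
          refine Finset.filter_eq_empty_iff.2 fun q hq h => ?_
          have := (p1 q hq).2; simp [h] at this
        rw [this]; simp
      · rw [if_neg (fun h => hxa h.symm)]
        exact p3 x (Finset.mem_erase.2 ⟨hxa, hx⟩)
    · intro u v
      rw [Finset.filter_insert]
      have h4 := p4 u v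
      by_cases he : s(u, v) ∈ p.edges
      · rw [if_pos he, Finset.card_insert_of_notMem (by simp [hnP])]
        push_cast
        rcases (x4 u v he).2 with ⟨h5, h6⟩ | ⟨h5, h6⟩
        · rw [h5, abs_of_nonneg (by omega)] at h4
          rw [abs_of_nonneg (by omega)]; omega
        · rw [hF v u] at h6
          rw [h5, abs_of_nonpos (by omega)] at h4
          rw [abs_of_nonpos (by omega)]; omega
      · rw [if_neg he]
        rwa [x3 u v he, sub_zero] at h4

/-- Augmentation. -/
lemma exists_flow [Fintype V] (H : SimpleGraph V) (c : ℕ) (A B : Finset V)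
    (hAB : Disjoint A B)
    (hcut : ∀ R : Finset V, (A ∩ R).card ≤ (B ∩ R).card + c * cutCard H R Rᶜ) (m : ℕ) :
    m ≤ A.card → ∃ F : V → V → ℤ, (∀ u v, F u v = - F v u) ∧ (∀ u v, F u v ≠ 0 → H.Adj u v) ∧
      (∀ u v, F u v ≤ c) ∧
      (∀ v ∈ A, ∑ u, F v u = 0 ∨ ∑ u, F v u = 1) ∧
      (∀ v ∈ B, ∑ u, F v u = 0 ∨ ∑ u, F v u = -1) ∧
      (∀ v, v ∉ A → v ∉ B → ∑ u, F v u = 0) ∧ ∑ v ∈ A, ∑ u, F v u = m := by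
  induction m with
  | zero => intro _; exact ⟨fun _ _ => 0, by simp, by simp, by simp, by simp, by simp, by simp, by simp⟩
  | succ m ih =>
    intro hm
    obtain ⟨F, hF, hadj, hcap, exA, exB, exO, hval⟩ := ih (by omega)
    by_cases hex : ∃ a ∈ A, ∃ b ∈ B, ∑ u, F a u = 0 ∧ ∑ u, F b u = 0 ∧
        Reach H (fun u v => F u v < c) a b
    · obtain ⟨a, ha, b, hb, ea, eb, hreach⟩ := hex
      obtain ⟨p, χ, x1, x2, x3, x4⟩ := hreach.flow
      have hab : a ≠ b := fun h => Finset.disjoint_left.1 hAB ha (h ▸ hb)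
      have hsum : ∀ v, ∑ u, (F v u + χ v u) =
          ∑ u, F v u + ((if v = a then 1 else 0) - (if v = b then 1 else 0)) := fun v => by
        rw [Finset.sum_add_distrib, x2]
      refine ⟨fun u v => F u v + χ u v, ?_, ?_, ?_, ?_, ?_, ?_, ?_⟩
      · intro u v
        have e1 := hF u v
        have e2 := x1 u v
        simp only [e1, e2]; ring
      · intro u v h
        by_cases he : s(u, v) ∈ p.edges
        · exact (x4 u v he).1
        · simp only [x3 u v he, add_zero] at h; exact hadj u v h
      · intro u v
        have := hcap u v
        by_cases he : s(u, v) ∈ p.edges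
        · rcases (x4 u v he).2 with ⟨h5, h6⟩ | ⟨h5, h6⟩ <;> simp only [h5] <;> omega
        · simp only [x3 u v he]; omega
      · intro v hv
        have hvb : v ≠ b := fun h => Finset.disjoint_left.1 hAB hv (h ▸ hb)
        rw [hsum, if_neg hvb]
        by_cases hva : v = a
        · subst hva; right; simp [ea]
        · simpa [hva] using exA v hv
      · intro v hv
        have hvb : v ≠ a := fun h => Finset.disjoint_left.1 hAB ha (h ▸ hv)
        rw [hsum, if_neg hvb]
        by_cases hva : v = b
        · subst hva; right; simp [eb]
        · simpa [hva] using exB v hv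
      · intro v hvA hvB
        have h1 : v ≠ a := fun h => hvA (h ▸ ha)
        have h2 : v ≠ b := fun h => hvB (h ▸ hb)
        rw [hsum, exO v hvA hvB]; simp [h1, h2]
      · have hbA : b ∉ A := Finset.disjoint_right.1 hAB hb
        simp only [hsum]
        rw [Finset.sum_add_distrib, hval, Finset.sum_sub_distrib]
        simp [ha, hbA]
    · exfalso
      push Not at hex
      set R : Finset V := Finset.univ.filter
        (fun v => ∃ a ∈ A, ∑ u, F a u = 0 ∧ Reach H (fun u v => F u v < c) a v) with hR
      have hmemR : ∀ v, v ∈ R ↔ ∃ a ∈ A, ∑ u, F a u = 0 ∧ Reach H (fun u v => F u v < c) a v := by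
        intro v; simp [hR]
      have h1 : ∑ v ∈ R, ∑ u, F v u = c * cutCard H R Rᶜ := by
        rw [sum_cut F hF, ← Finset.sum_product', cutCard, Finset.card_filter]
        push_cast
        rw [Finset.mul_sum]
        refine Finset.sum_congr rfl fun x hx => ?_
        rw [Finset.mem_product, Finset.mem_compl] at hx
        by_cases hx' : H.Adj x.1 x.2
        · rw [if_pos hx', mul_one]
          refine le_antisymm (hcap _ _) ?_
          by_contra hlt
          push Not at hlt
          obtain ⟨a, ha, ea, hre⟩ := (hmemR _).1 hx.1
          exact hx.2 ((hmemR _).2 ⟨a, ha, ea, hre.step hx' hlt⟩)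
        · rw [if_neg hx', mul_zero]
          by_contra h; exact hx' (hadj _ _ h)
      have hB : ∀ v ∈ B ∩ R, ∑ u, F v u = -1 := by
        intro v hv
        rw [Finset.mem_inter] at hv
        obtain ⟨a, ha, ea, hre⟩ := (hmemR _).1 hv.2
        rcases exB v hv.1 with h | h
        · exact absurd hre (hex a ha v hv.1 ea h)
        · exact h
      have h2 : ∑ v ∈ R, ∑ u, F v u =
          ∑ v ∈ A ∩ R, ∑ u, F v u - (B ∩ R).card := by
        have e1 : ∑ v ∈ (A ∩ R) ∪ (B ∩ R), ∑ u, F v u = ∑ v ∈ R, ∑ u, F v u := by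
          refine Finset.sum_subset (by intro x; simp; tauto) fun v hv hv' => ?_
          simp only [Finset.mem_union, Finset.mem_inter, hv, and_true, not_or] at hv'
          exact exO v hv'.1 hv'.2
        rw [← e1, Finset.sum_union (hAB.mono Finset.inter_subset_left Finset.inter_subset_left),
          Finset.sum_congr rfl hB]
        simp; ring
      have h3 : ∑ v ∈ A ∩ R, ∑ u, F v u + (A \ R).card = m := by
        have e2 : ∑ v ∈ A \ R, ∑ u, F v u = (A \ R).card := by
          rw [Finset.sum_congr rfl (g := fun _ => (1:ℤ))]
          · simp
          · intro v hv
            rw [Finset.mem_sdiff] at hv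
            rcases exA v hv.1 with h | h
            · exact absurd ((hmemR v).2 ⟨v, hv.1, h, Reach.refl _ _ _⟩) hv.2
            · exact h
        rw [← e2, Finset.sum_inter_add_sum_sdiff, hval]
      have h4 := Finset.card_inter_add_card_sdiff A R
      have h5 := hcut R
      zify at h4 h5 hm
      linarith

lemma maxflow [Fintype V] (H : SimpleGraph V) (c : ℕ) (A B : Finset V)
    (hAB : Disjoint A B) (hcard : A.card = B.card)
    (hcut : ∀ R : Finset V, (A ∩ R).card ≤ (B ∩ R).card + c * cutCard H R Rᶜ) :
    HasUnitFlowIn H Finset.univ A B c := by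
  obtain ⟨F, hF, hadj, hcap, exA, exB, exO, hval⟩ := exists_flow H c A B hAB hcut A.card le_rfl
  have hA : ∀ v ∈ A, ∑ u, F v u = 1 := by
    have : ∑ v ∈ A, ∑ u, F v u = ∑ v ∈ A, (1:ℤ) := by rw [hval]; simp
    refine (Finset.sum_eq_sum_iff_of_le ?_).1 this
    intro v hv; rcases exA v hv with h | h <;> omega
  have hB : ∀ v ∈ B, (-1 : ℤ) = ∑ u, F v u := by
    have h0 : ∑ v, ∑ u, F v u = 0 := by rw [sum_cut F hF]; simp
    have h1 : ∑ v ∈ A ∪ B, ∑ u, F v u = ∑ v, ∑ u, F v u := by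
      refine Finset.sum_subset (Finset.subset_univ _) fun v _ hv => ?_
      rw [Finset.mem_union, not_or] at hv
      exact exO v hv.1 hv.2
    rw [Finset.sum_union hAB, hval, h0] at h1
    refine (Finset.sum_eq_sum_iff_of_le ?_).1 ?_
    · intro v hv; rcases exB v hv with h | h <;> omega
    · simp; omega
  obtain ⟨P, p1, p2, p3, p4⟩ := decompose H A.card A B F rfl hcard.symm hAB hF hadj (by
    intro v
    by_cases h1 : v ∈ A
    · rw [hA v h1]; simp [h1, Finset.disjoint_left.1 hAB h1]
    by_cases h2 : v ∈ B
    · rw [← hB v h2]; simp [h1, h2]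
    rw [exO v h1 h2]; simp [h1, h2])
  refine ⟨P, fun _ => 1, by simp, p1, by simp, ?_, ?_, ?_⟩
  · intro a ha; simp [p2 a ha]
  · intro a ha; simp [p3 a ha]
  · intro e
    induction e with
    | h u v =>
      have h1 := p4 u v
      have h2 : |F u v| ≤ c := by
        rw [abs_le]; have := hcap v u; have := hcap u v; have := hF u v; omega
      have h3 := h1.trans h2
      simp only [Finset.sum_const, nsmul_eq_mul, mul_one]
      exact_mod_cast h3

lemma tight_cut [Fintype V] (H : SimpleGraph V) (T : Finset V)
    (h : ¬ WellLinked H T (1 / 3)) :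
    ∃ R : Finset V, 3 * cutCard H R Rᶜ < (T ∩ R).card ∧ 3 * cutCard H R Rᶜ < (T \ R).card := by
  by_contra hcon
  push Not at hcon
  apply h
  intro A B hA hB hAB hcard
  have : (1 / (1 / 3) : ℝ) = ((3:ℕ) : ℝ) := by norm_num
  rw [this]
  refine maxflow H 3 A B hAB hcard fun R => ?_
  by_contra hlt
  push Not at hlt
  have h1 : (A ∩ R).card ≤ (T ∩ R).card :=
    Finset.card_le_card (Finset.inter_subset_inter_right hA)
  have h2 : (B \ R).card ≤ (T \ R).card :=
    Finset.card_le_card (Finset.sdiff_subset_sdiff hB le_rfl)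
  have h3 := Finset.card_inter_add_card_sdiff A R
  have h4 := Finset.card_inter_add_card_sdiff B R
  have := hcon R (by omega)
  omega

lemma cut_of_flow [Fintype V] (G : SimpleGraph V) (C A B R : Finset V) (η : ℝ)
    (h : HasUnitFlowIn G C A B η) (hA : A ⊆ R) (hB : B ⊆ Rᶜ) :
    (A.card : ℝ) ≤ η * cutCard G R Rᶜ := by
  obtain ⟨P, f, f0, fAB, -, fA, -, fe⟩ := h
  have h1 : (A.card : ℝ) = ∑ p ∈ P, f p := by
    rw [← Finset.sum_fiberwise_of_maps_to (fun p hp => (fAB p hp).1), Finset.sum_congr rfl fA]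
    simp
  set K := (R ×ˢ Rᶜ).filter (fun ab => G.Adj ab.1 ab.2) with hK
  have h2 : ∑ p ∈ P, f p ≤ ∑ p ∈ P, ∑ x ∈ K, if s(x.1, x.2) ∈ p.2.2.edges then f p else 0 := by
    refine Finset.sum_le_sum fun p hp => ?_
    obtain ⟨d, hd, d1, d2⟩ := p.2.2.exists_boundary_dart (R : Set V)
      (by exact_mod_cast hA (fAB p hp).1)
      (by have := hB (fAB p hp).2; simpa using this)
    have hdK : (d.fst, d.snd) ∈ K := by
      simp only [hK, Finset.mem_filter, Finset.mem_product, Finset.mem_compl]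
      exact ⟨⟨by simpa using d1, by simpa using d2⟩, d.adj⟩
    have hde : s(d.fst, d.snd) ∈ p.2.2.edges := List.mem_map.2 ⟨d, hd, rfl⟩
    calc f p = if s((d.fst, d.snd).1, (d.fst, d.snd).2) ∈ p.2.2.edges then f p else 0 := by
          simp only; rw [if_pos hde]
      _ ≤ _ := Finset.single_le_sum
          (f := fun x : V × V => if s(x.1, x.2) ∈ p.2.2.edges then f p else 0)
          (fun x _ => by
            split_ifs
            · exact f0 p hp
            · exact le_rfl) hdK
  rw [Finset.sum_comm] at h2
  have h3 : ∑ x ∈ K, ∑ p ∈ P, (if s(x.1, x.2) ∈ p.2.2.edges then f p else 0) ≤ ∑ x ∈ K, η := by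
    refine Finset.sum_le_sum fun x _ => ?_
    rw [← Finset.sum_filter]
    exact fe _
  rw [Finset.sum_const, nsmul_eq_mul] at h3
  have h4 : (cutCard G R Rᶜ : ℝ) = K.card := rfl
  rw [h1, h4, mul_comm]
  exact h2.trans h3

lemma cutCard_eq_sum [Fintype V] (G : SimpleGraph V) (R : Finset V) :
    cutCard G R Rᶜ = ∑ x : V × V, if x.1 ∈ R ∧ x.2 ∉ R ∧ G.Adj x.1 x.2 then 1 else 0 := by
  rw [cutCard, ← Finset.card_filter]
  congr 1
  ext x
  simp [and_assoc]

lemma cutCard_compl [Fintype V] (G : SimpleGraph V) (R : Finset V) :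
    cutCard G Rᶜ Rᶜᶜ = cutCard G R Rᶜ := by
  rw [cutCard_eq_sum, cutCard_eq_sum, ← Equiv.sum_comp (Equiv.prodComm V V)]
  refine Finset.sum_congr rfl fun x _ => ?_
  refine if_congr ?_ rfl rfl
  simp [G.adj_comm x.1 x.2]
  tauto

lemma cutCard_submod [Fintype V] (G : SimpleGraph V) (B X : Finset V) :
    cutCard G (B ∩ X) (B ∩ X)ᶜ + cutCard G (B ∪ X) (B ∪ X)ᶜ
      ≤ cutCard G B Bᶜ + cutCard G X Xᶜ := by
  simp only [cutCard_eq_sum]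
  rw [← Finset.sum_add_distrib, ← Finset.sum_add_distrib]
  refine Finset.sum_le_sum fun x _ => ?_
  simp only [Finset.mem_inter, Finset.mem_union]
  by_cases h1 : x.1 ∈ B <;> by_cases h2 : x.2 ∈ B <;> by_cases h3 : x.1 ∈ X <;>
    by_cases h4 : x.2 ∈ X <;> by_cases h5 : G.Adj x.1 x.2 <;> simp [h1, h2, h3, h4, h5]

/-- The smaller side of a well-linked set. -/
lemma small_side [Fintype V] (G : SimpleGraph V) (C T : Finset V) (α : ℝ) (hα : 0 < α)
    (h : WellLinkedIn G C T α) (R : Finset V) (hR : (T ∩ R).card ≤ (T \ R).card) :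
    α * (T ∩ R).card ≤ cutCard G R Rᶜ := by
  obtain ⟨B, hB, hBc⟩ := Finset.exists_subset_card_eq hR
  have := cut_of_flow G C (T ∩ R) B R _ (h (T ∩ R) B Finset.inter_subset_left
    (hB.trans Finset.sdiff_subset)
    (Finset.disjoint_left.2 fun x hx hx' => by
      have := hB hx'; simp at hx this; tauto) hBc.symm) Finset.inter_subset_right
    (fun x hx => by have := hB hx; simp at this; simp [this.2])
  calc α * (T ∩ R).card ≤ α * (1 / α * cutCard G R Rᶜ) := by gcongr
    _ = _ := by field_simp

lemma small_side' [Fintype V] (G : SimpleGraph V) (C T : Finset V) (α : ℝ) (hα : 0 < α)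
    (h : WellLinkedIn G C T α) (R : Finset V) (hR : (T \ R).card ≤ (T ∩ R).card) :
    α * (T \ R).card ≤ cutCard G R Rᶜ := by
  have e1 : T ∩ Rᶜ = T \ R := by ext; simp
  have e2 : T \ Rᶜ = T ∩ R := by ext; simp
  have := small_side G C T α hα h Rᶜ (by rw [e1, e2]; exact hR)
  rwa [e1, cutCard_compl] at this

lemma cutCard_delete [Fintype V] (G : SimpleGraph V) (x y : V) (R : Finset V) (hx : x ∈ R)
    (hy : y ∉ R) : cutCard G R Rᶜ ≤ cutCard (G.deleteEdges {s(x, y)}) R Rᶜ + 1 := by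
  rw [cutCard, cutCard]
  rw [← Finset.card_singleton (x, y)]
  refine (Finset.card_le_card ?_).trans (Finset.card_union_le _ _)
  intro z hz
  simp only [Finset.mem_filter, Finset.mem_product, Finset.mem_compl, Finset.mem_union,
    Finset.mem_singleton, SimpleGraph.deleteEdges_adj, Set.mem_singleton_iff, Sym2.eq_iff] at hz ⊢
  by_cases h : z = (x, y)
  · exact Or.inr h
  · left
    refine ⟨hz.1, hz.2, ?_⟩
    rintro (⟨h1, h2⟩ | ⟨h1, h2⟩)
    · exact h (Prod.ext h1 h2)
    · exact hy (h1 ▸ hz.1.1)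

lemma cutCard_delete_same [Fintype V] (G : SimpleGraph V) (x y : V) (R : Finset V)
    (hxy : x ∈ R ↔ y ∈ R) : cutCard G R Rᶜ ≤ cutCard (G.deleteEdges {s(x, y)}) R Rᶜ := by
  rw [cutCard, cutCard]
  refine Finset.card_le_card ?_
  intro z hz
  simp only [Finset.mem_filter, Finset.mem_product, Finset.mem_compl,
    SimpleGraph.deleteEdges_adj, Set.mem_singleton_iff, Sym2.eq_iff] at hz ⊢
  refine ⟨hz.1, hz.2, ?_⟩
  rintro (⟨h1, h2⟩ | ⟨h1, h2⟩) <;> rw [h1, h2] at hz <;> tauto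

/-- A tight cut through an undeletable edge; the side can be chosen. -/
lemma tight_cut_edge [Fintype V] (G : SimpleGraph V) (T : Finset V)
    (hwl : WellLinked G T (1 / 3)) (x y : V)
    (h : ¬ WellLinked (G.deleteEdges {s(x, y)}) T (1 / 3)) :
    ∃ R : Finset V, ((x ∈ R ∧ y ∉ R) ∨ (x ∉ R ∧ y ∈ R)) ∧
      3 * cutCard G R Rᶜ < (T ∩ R).card + 3 ∧ 3 * cutCard G R Rᶜ < (T \ R).card + 3 := by
  obtain ⟨R, h1, h2⟩ := tight_cut _ T h
  have hiff : ¬ (x ∈ R ↔ y ∈ R) := by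
    intro hxy
    have h3 := cutCard_delete_same G x y R hxy
    rcases le_total (T ∩ R).card (T \ R).card with hle | hle
    · have := small_side G _ T (1/3) (by norm_num) hwl R hle
      have : ((T ∩ R).card : ℝ) ≤ (3 * cutCard G R Rᶜ : ℕ) := by push_cast; linarith
      have := Nat.cast_le.1 this
      omega
    · have := small_side' G _ T (1/3) (by norm_num) hwl R hle
      have : ((T \ R).card : ℝ) ≤ (3 * cutCard G R Rᶜ : ℕ) := by push_cast; linarith
      have := Nat.cast_le.1 this
      omega
  refine ⟨R, by tauto, ?_⟩
  have : cutCard G R Rᶜ ≤ cutCard (G.deleteEdges {s(x, y)}) R Rᶜ + 1 := by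
    by_cases hx : x ∈ R
    · exact cutCard_delete G x y R hx (by tauto)
    · rw [Sym2.eq_swap]; exact cutCard_delete G y x R (by tauto) hx
  omega

lemma cut_terminals [Fintype V] (G : SimpleGraph V) (T : Finset V) (d : ℕ)
    (hd : ∀ v, deg G v ≤ d) : cutCard G Tᶜ Tᶜᶜ ≤ T.card * d := by
  rw [cutCard_compl, cutCard]
  calc _ ≤ (T.sigma (fun v => Finset.univ.filter (fun u => G.Adj v u))).card := by
        refine Finset.card_le_card_of_injOn (fun x => ⟨x.1, x.2⟩) ?_ ?_
        · intro x hx; simp at hx ⊢; tauto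
        · intro x _ y _ h; simp at h; exact Prod.ext h.1 h.2
    _ = ∑ v ∈ T, deg G v := by rw [Finset.card_sigma]; rfl
    _ ≤ _ := by
      rw [← smul_eq_mul]; exact Finset.sum_le_card_nsmul _ _ _ (fun v _ => hd v)

lemma wl_cut [Fintype V] (G : SimpleGraph V) (T : Finset V)
    (hwl : WellLinked G T (1 / 3)) (R : Finset V) :
    (T ∩ R).card ≤ 3 * cutCard G R Rᶜ ∨ (T \ R).card ≤ 3 * cutCard G R Rᶜ := by
  rcases le_total (T ∩ R).card (T \ R).card with hle | hle
  · left
    have := small_side G _ T (1/3) (by norm_num) hwl R hle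
    have : ((T ∩ R).card : ℝ) ≤ (3 * cutCard G R Rᶜ : ℕ) := by push_cast; linarith
    exact Nat.cast_le.1 this
  · right
    have := small_side' G _ T (1/3) (by norm_num) hwl R hle
    have : ((T \ R).card : ℝ) ≤ (3 * cutCard G R Rᶜ : ℕ) := by push_cast; linarith
    exact Nat.cast_le.1 this

lemma bdry_subset (G : SimpleGraph V) (S : Finset V) : bdry G S ⊆ S :=
  Finset.filter_subset _ _

lemma bdry_nb (G : SimpleGraph V) (S : Finset V) : ∀ v ∈ bdry G S, ∃ u, G.Adj v u := by
  intro v hv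
  obtain ⟨u, -, hu⟩ := (Finset.mem_filter.1 hv).2
  exact ⟨u, hu⟩

lemma bdry_out [Fintype V] (G : SimpleGraph V) (S X : Finset V)
    (hedge : ∀ x ∈ X, ∀ y ∈ X, ¬ G.Adj x y) : (bdry G S ∩ X).card ≤ cutCard G X Xᶜ := by
  have hnb := bdry_nb G S
  choose! g hg using hnb
  rw [cutCard]
  refine Finset.card_le_card_of_injOn (fun v => (v, g v)) ?_ ?_
  · intro v hv
    have hv' := Finset.mem_inter.1 (Finset.mem_coe.1 hv)
    have hadj := hg v hv'.1
    simp only [Finset.coe_filter, Finset.mem_product, Finset.mem_compl, Set.mem_setOf_eq]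
    exact ⟨⟨hv'.2, fun h => hedge v hv'.2 _ h hadj⟩, hadj⟩
  · intro v _ w _ h
    exact (Prod.ext_iff.1 h).1

set_option maxHeartbeats 1000000 in
/-- Suppose `T₁, T₂` are disjoint node-well-linked sets of size `κ`
each, `T₁ ∪ T₂` is `1/3`-well-linked in `G`, `G` is edge-minimal subject to the latter
property, and the maximum degree of `G` is at most `d`.  Then every cluster `S` disjoint
from `T₁ ∪ T₂` whose boundary is `α'`-well-linked in `G[S]` satisfies
`|Γ(S)| ≤ 12κd/α'`. -/
theorem stmt18 [Fintype V] (G : SimpleGraph V)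
    (d : ℕ) (hd : ∀ v, deg G v ≤ d)
    (T₁ T₂ : Finset V) (hdisj : Disjoint T₁ T₂) (κ : ℕ)
    (hc1 : T₁.card = κ) (hc2 : T₂.card = κ)
    (hn1 : NodeWellLinked G T₁) (hn2 : NodeWellLinked G T₂)
    (hwl : WellLinked G (T₁ ∪ T₂) (1 / 3))
    (hmin : ∀ e ∈ G.edgeSet, ¬ WellLinked (G.deleteEdges {e}) (T₁ ∪ T₂) (1 / 3))
    (S : Finset V) (hS : ∀ v ∈ S, v ∉ T₁ ∪ T₂)
    (α' : ℝ) (hα'0 : 0 < α') (hα'1 : α' < 1)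
    (hSwl : WellLinkedIn G S (bdry G S) α') :
    ((bdry G S).card : ℝ) ≤ 12 * (κ : ℝ) * (d : ℝ) / α' := by
  by_contra hcon
  push Not at hcon
  set Γ := bdry G S with hΓ
  set T := T₁ ∪ T₂ with hT
  have hTc : T.card = 2 * κ := by rw [hT, Finset.card_union_of_disjoint hdisj]; omega
  have hn : 6 * (2 * κ * d : ℝ) < α' * Γ.card := by
    rw [div_lt_iff₀ hα'0] at hcon; linarith
  have hΓS : Γ ⊆ S := bdry_subset G S
  have hD0 : (0:ℝ) ≤ 2 * κ * d := by positivity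
  have hn0 : (0:ℝ) < Γ.card := by
    by_contra h0
    have : (Γ.card : ℝ) = 0 := le_antisymm (not_lt.1 h0) (by positivity)
    rw [this] at hn; linarith
  -- the family of candidate sets
  set Fam : Finset (Finset V) := Finset.univ.filter
    (fun Z => Disjoint Z T ∧ Γ.card < 2 * (Γ ∩ Z).card) with hFam
  have hmem : ∀ Z, Z ∈ Fam ↔ Disjoint Z T ∧ Γ.card < 2 * (Γ ∩ Z).card := by
    intro Z; simp [hFam]
  have hTF : Tᶜ ∈ Fam := by
    rw [hmem]
    refine ⟨disjoint_compl_left, ?_⟩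
    have : Γ ∩ Tᶜ = Γ := Finset.inter_eq_left.2 fun v hv => Finset.mem_compl.2 (hS v (hΓS hv))
    rw [this]
    have : 0 < Γ.card := by exact_mod_cast hn0
    omega
  obtain ⟨X, hX, hXmin⟩ := Finset.exists_min_image Fam
    (fun Z => toLex (cutCard G Z Zᶜ, Z.card)) ⟨_, hTF⟩
  have hXT := ((hmem X).1 hX).1
  have hXΓ := ((hmem X).1 hX).2
  have hXcut : cutCard G X Xᶜ ≤ 2 * κ * d := by
    have h1 := hXmin _ hTF
    have h2 := cut_terminals G T d hd
    rw [Prod.Lex.toLex_le_toLex] at h1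
    rw [hTc] at h2
    simp only at h1
    omega
  have hXcutR : (cutCard G X Xᶜ : ℝ) ≤ 2 * κ * d := by exact_mod_cast hXcut
  have hsplit := Finset.card_inter_add_card_sdiff Γ X
  have hXs := small_side' G S Γ α' hα'0 hSwl X (by omega)
  have hXsmall : 6 * ((Γ \ X).card : ℝ) < Γ.card := by
    refine lt_of_mul_lt_mul_left ?_ hα'0.le
    linarith
  -- no edge inside X
  have hedge : ∀ x ∈ X, ∀ y ∈ X, ¬ G.Adj x y := by
    intro x hx y hy hadj
    obtain ⟨R, hR, hR1, hR2⟩ := tight_cut_edge G T hwl x y (hmin _ hadj)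
    have hd1 : 1 ≤ d := le_trans (Finset.card_pos.2 ⟨y, by simpa using hadj⟩) (hd x)
    -- choose the big side
    obtain ⟨B, hB, hB1, hB2, hBs⟩ : ∃ B : Finset V, ((x ∈ B ∧ y ∉ B) ∨ (x ∉ B ∧ y ∈ B)) ∧
        3 * cutCard G B Bᶜ < (T ∩ B).card + 3 ∧ 3 * cutCard G B Bᶜ < (T \ B).card + 3 ∧
        (Γ \ B).card ≤ (Γ ∩ B).card := by
      rcases le_total (Γ \ R).card (Γ ∩ R).card with hle | hle
      · exact ⟨R, hR, hR1, hR2, hle⟩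
      · have e1 : ∀ Q : Finset V, Q ∩ Rᶜ = Q \ R := fun Q => by ext; simp
        have e2 : ∀ Q : Finset V, Q \ Rᶜ = Q ∩ R := fun Q => by ext; simp
        refine ⟨Rᶜ, ?_, ?_, ?_, ?_⟩
        · simp only [Finset.mem_compl, not_not]; tauto
        · rw [cutCard_compl, e1]; exact hR2
        · rw [cutCard_compl, e2]; exact hR1
        · rw [e1, e2]; exact hle
    have hTs := Finset.card_inter_add_card_sdiff T B
    have hBcut : cutCard G B Bᶜ ≤ 2 * κ * d := by
      have h1 : cutCard G B Bᶜ ≤ 2 * κ := by omega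
      exact h1.trans (Nat.le_mul_of_pos_right _ hd1)
    have hBcutR : (cutCard G B Bᶜ : ℝ) ≤ 2 * κ * d := by exact_mod_cast hBcut
    have hBw := small_side' G S Γ α' hα'0 hSwl B hBs
    have hBsmall : 6 * ((Γ \ B).card : ℝ) < Γ.card := by
      refine lt_of_mul_lt_mul_left ?_ hα'0.le
      linarith
    have hBX : B ∩ X ∈ Fam := by
      rw [hmem]
      refine ⟨hXT.mono_left Finset.inter_subset_right, ?_⟩
      have h1 := Finset.card_inter_add_card_sdiff Γ (B ∩ X)
      have h2 : (Γ \ (B ∩ X)).card ≤ (Γ \ B).card + (Γ \ X).card := by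
        refine (Finset.card_le_card ?_).trans (Finset.card_union_le _ _)
        intro v; simp; tauto
      have h3 : 6 * (Γ \ B).card < Γ.card := by exact_mod_cast hBsmall
      have h4 : 6 * (Γ \ X).card < Γ.card := by exact_mod_cast hXsmall
      omega
    have hlt : (B ∩ X).card < X.card := by
      refine Finset.card_lt_card ⟨Finset.inter_subset_right, fun hsub => ?_⟩
      have h1 := hsub hx
      have h2 := hsub hy
      simp only [Finset.mem_inter] at h1 h2
      tauto
    have hmn := hXmin _ hBX
    rw [Prod.Lex.toLex_le_toLex] at hmn
    simp only at hmn
    have hsub := cutCard_submod G B X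
    have e1 : T ∩ (B ∪ X) = T ∩ B := by
      ext v
      have := fun h : v ∈ X => Finset.disjoint_left.1 hXT h
      simp only [Finset.mem_inter, Finset.mem_union]; tauto
    have e2 : T \ (B ∪ X) = T \ B := by
      ext v
      have := fun h : v ∈ X => Finset.disjoint_left.1 hXT h
      simp only [Finset.mem_sdiff, Finset.mem_union]; tauto
    have hw := wl_cut G T hwl (B ∪ X)
    rw [e1, e2] at hw
    clear hmin hn1 hn2 hSwl hwl
    rcases hw with hw | hw <;> omega
  -- every boundary vertex in X contributes an edge leaving X
  have hout : (Γ ∩ X).card ≤ cutCard G X Xᶜ := bdry_out G S X hedge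
  have houtR : ((Γ ∩ X).card : ℝ) ≤ cutCard G X Xᶜ := by exact_mod_cast hout
  have hsplitR : ((Γ ∩ X).card : ℝ) + (Γ \ X).card = Γ.card := by exact_mod_cast hsplit
  have : α' * (Γ.card : ℝ) < 1 * Γ.card := mul_lt_mul_of_pos_right hα'1 hn0
  linarith
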